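/- Let m ≥ 0 be an integer, let x_0 < x_1 < ⋯ < x_{m+1} be real numbers, and let c_1, …, c_{m+1} be arbitrary real numbers. Then there exists a unique polynomial q of degree at most m such that (1/(x_j − x_{j−1})) ∫_{x_{j−1}}^{x_j} q(x) dx = c_j for every j = 1, …, m+1. -/

import Mathlib

open Polynomial in
theorem Polynomial.derivative_surjective_of_field_charZero {K : Type*} [Field K] [CharZero K] :
    Function.Surjective (derivative : K[X] → K[X]) := by
  intro q
  induction q using Polynomial.induction_on' with
  | add p q hp hq =>
    obtain ⟨P, rfl⟩ := hp
    obtain ⟨Q, rfl⟩ := hq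
    exact ⟨P + Q, derivative_add⟩
  | monomial n a =>
    refine ⟨monomial (n + 1) (a / (n + 1)), ?_⟩
    rw [derivative_monomial]
    have : (n : K) + 1 ≠ 0 := by exact_mod_cast n.succ_ne_zero
    push_cast
    rw [div_mul_cancel₀ _ this]

open Polynomial in
theorem Polynomial.degree_lt_of_degree_derivative_le {K : Type*} [Field K] [CharZero K]
    {P : K[X]} {m : ℕ} (h : (derivative P).degree ≤ m) : P.degree < (m + 2 : ℕ) := by
  rcases Nat.eq_zero_or_pos P.natDegree with h0 | h0
  · exact (degree_le_of_natDegree_le h0.le).trans_lt (by exact_mod_cast Nat.succ_pos _)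
  · rw [degree_derivative h0.ne'] at h
    have : P.natDegree - 1 ≤ m := by exact_mod_cast h
    exact degree_le_natDegree.trans_lt (by exact_mod_cast (by omega : P.natDegree < m + 2))

theorem Polynomial.integral_eval_derivative (P : Polynomial ℝ) (a b : ℝ) :
    ∫ t in a..b, (derivative P).eval t = P.eval b - P.eval a :=
  intervalIntegral.integral_eq_sub_of_hasDerivAt (fun t _ => P.hasDerivAt t)
    ((derivative P).continuous.intervalIntegrable _ _)

/-- Existence and uniqueness of a polynomial of degree at most `m` with prescribed
averages over `m+1` consecutive intervals. -/
theorem polynomial_reconstruction_from_cell_averages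
    (m : ℕ) (x : Fin (m + 2) → ℝ) (hx : StrictMono x) (c : Fin (m + 1) → ℝ) :
    ∃! q : Polynomial ℝ, q.degree ≤ m ∧
      ∀ j : Fin (m + 1),
        (1 / (x j.succ - x j.castSucc)) *
          ∫ t in (x j.castSucc)..(x j.succ), q.eval t = c j := by
  have hlen (j : Fin (m + 1)) : x j.succ - x j.castSucc ≠ 0 :=
    (sub_pos.2 (hx j.castSucc_lt_succ)).ne'
  have hinj : Set.InjOn x (Finset.univ : Finset (Fin (m + 2))) := hx.injective.injOn
  have hcell (q : Polynomial ℝ) (j : Fin (m + 1)) :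
      (1 / (x j.succ - x j.castSucc)) * ∫ t in (x j.castSucc)..(x j.succ), q.eval t = c j ↔
        ∫ t in (x j.castSucc)..(x j.succ), q.eval t = c j * (x j.succ - x j.castSucc) := by
    rw [one_div_mul_eq_div, div_eq_iff (hlen j)]
  simp only [hcell]
  obtain ⟨S, hS⟩ : ∃ S : Fin (m + 2) → ℝ, ∀ j : Fin (m + 1),
      S j.succ - S j.castSucc = c j * (x j.succ - x j.castSucc) :=
    ⟨Fin.induction 0 fun j s => s + c j * (x j.succ - x j.castSucc), fun j => by simp⟩
  refine existsUnique_of_exists_of_unique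
    ⟨Polynomial.derivative (Lagrange.interpolate Finset.univ x S), ?_, fun j => ?_⟩ ?_
  · have hdeg := Lagrange.degree_interpolate_lt S hinj
    rw [Finset.card_univ, Fintype.card_fin] at hdeg
    have hnat : (Lagrange.interpolate Finset.univ x S).natDegree ≤ m + 1 :=
      Polynomial.natDegree_le_iff_coeff_eq_zero.2 fun N hN =>
        (Polynomial.degree_lt_iff_coeff_zero _ _).1 hdeg N hN
    refine Polynomial.degree_le_of_natDegree_le ((Polynomial.natDegree_derivative_le _).trans ?_)
    omega
  · rw [Polynomial.integral_eval_derivative,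
      Lagrange.eval_interpolate_at_node _ hinj (Finset.mem_univ _),
      Lagrange.eval_interpolate_at_node _ hinj (Finset.mem_univ _), hS]
  · rintro p q ⟨hp, hpc⟩ ⟨hq, hqc⟩
    obtain ⟨P, rfl⟩ := Polynomial.derivative_surjective_of_field_charZero p
    obtain ⟨Q, rfl⟩ := Polynomial.derivative_surjective_of_field_charZero q
    simp only [Polynomial.integral_eval_derivative] at hpc hqc
    have hnode (i : Fin (m + 2)) :
        P.eval (x i) = (Q + Polynomial.C (P.eval (x 0) - Q.eval (x 0))).eval (x i) := by
      rw [Polynomial.eval_add, Polynomial.eval_C]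
      induction i using Fin.induction with
      | zero => ring
      | succ j ih => linarith [hpc j, hqc j]
    have hcard : (Finset.univ : Finset (Fin (m + 2))).card = m + 2 := by simp
    have hPQ := Polynomial.eq_of_degrees_lt_of_eval_index_eq Finset.univ hinj
      (by rw [hcard]; exact Polynomial.degree_lt_of_degree_derivative_le hp)
      (by
        rw [hcard]
        exact Polynomial.degree_lt_of_degree_derivative_le (by simpa using hq))
      (fun i _ => hnode i)
    simpa using congrArg Polynomial.derivative hPQ
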